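/- Let X and Y be n×d real matrices with X ≠ 0 and Y ≠ 0. Then ‖ (XXᵀ)/‖X‖_F² − (YYᵀ)/‖Y‖_F² ‖_F ≤ 4‖X − Y‖_F/‖X‖_F. -/

import Mathlib

open Finset Matrix

/-- The Frobenius norm of a real matrix. -/
noncomputable def frobNorm {n m : ℕ} (M : Matrix (Fin n) (Fin m) ℝ) : ℝ :=
  Real.sqrt (∑ i, ∑ j, (M i j) ^ 2)

/-- Normalization to the unit sphere satisfies
`‖x/‖x‖ - y/‖y‖‖ ≤ 2‖x - y‖/‖x‖`. -/
theorem norm_inv_norm_smul_sub_le {E : Type*} [NormedAddCommGroup E] [NormedSpace ℝ E]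
    {x y : E} (hx : x ≠ 0) (hy : y ≠ 0) :
    ‖‖x‖⁻¹ • x - ‖y‖⁻¹ • y‖ ≤ 2 * ‖x - y‖ / ‖x‖ := by
  have ha : 0 < ‖x‖ := norm_pos_iff.mpr hx
  have hb : 0 < ‖y‖ := norm_pos_iff.mpr hy
  have hdecomp : ‖x‖⁻¹ • x - ‖y‖⁻¹ • y = ‖x‖⁻¹ • ((x - y) + (‖y‖ - ‖x‖) • ‖y‖⁻¹ • y) := by
    have hc : ‖y‖⁻¹ = ‖x‖⁻¹ - ‖x‖⁻¹ * ((‖y‖ - ‖x‖) * ‖y‖⁻¹) := by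
      field_simp
      ring
    conv_lhs => rw [hc]
    module
  have hunit : ‖‖y‖⁻¹ • y‖ = 1 := by
    rw [norm_smul, norm_inv, norm_norm, inv_mul_cancel₀ hb.ne']
  have hdiff : ‖(‖y‖ - ‖x‖) • ‖y‖⁻¹ • y‖ ≤ ‖x - y‖ := by
    rw [norm_smul, hunit, mul_one, Real.norm_eq_abs, norm_sub_rev x y]
    exact abs_norm_sub_norm_le y x
  rw [hdecomp, norm_smul, norm_inv, norm_norm, div_eq_inv_mul]
  gcongr
  linarith [norm_add_le (x - y) ((‖y‖ - ‖x‖) • ‖y‖⁻¹ • y)]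

section FrobeniusNorm

attribute [local instance] Matrix.frobeniusNormedAddCommGroup Matrix.frobeniusNormedSpace

theorem frobNorm_eq_norm {n m : ℕ} (M : Matrix (Fin n) (Fin m) ℝ) : frobNorm M = ‖M‖ := by
  rw [frobNorm, Matrix.frobenius_norm_def, Real.sqrt_eq_rpow]
  simp

theorem frobenius_norm_gram_sub_le {m n : Type*} [Fintype m] [Fintype n] (Z W : Matrix m n ℝ) :
    ‖Z * Zᵀ - W * Wᵀ‖ ≤ (‖Z‖ + ‖W‖) * ‖Z - W‖ := by
  have h : Z * Zᵀ - W * Wᵀ = Z * (Z - W)ᵀ + (Z - W) * Wᵀ := by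
    rw [Matrix.transpose_sub, Matrix.mul_sub, Matrix.sub_mul]
    abel
  calc ‖Z * Zᵀ - W * Wᵀ‖ ≤ ‖Z * (Z - W)ᵀ‖ + ‖(Z - W) * Wᵀ‖ := h ▸ norm_add_le _ _
    _ ≤ ‖Z‖ * ‖(Z - W)ᵀ‖ + ‖Z - W‖ * ‖Wᵀ‖ :=
      add_le_add (Matrix.frobenius_norm_mul _ _) (Matrix.frobenius_norm_mul _ _)
    _ = (‖Z‖ + ‖W‖) * ‖Z - W‖ := by
      rw [Matrix.frobenius_norm_transpose, Matrix.frobenius_norm_transpose]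
      ring

theorem frobenius_norm_normalized_gram_sub_le {m n : Type*} [Fintype m] [Fintype n]
    {X Y : Matrix m n ℝ} (hX : X ≠ 0) (hY : Y ≠ 0) :
    ‖(‖X‖ ^ 2)⁻¹ • (X * Xᵀ) - (‖Y‖ ^ 2)⁻¹ • (Y * Yᵀ)‖ ≤ 4 * ‖X - Y‖ / ‖X‖ := by
  have hgram (M : Matrix m n ℝ) :
      (‖M‖ ^ 2)⁻¹ • (M * Mᵀ) = (‖M‖⁻¹ • M) * (‖M‖⁻¹ • M)ᵀ := by
    rw [Matrix.transpose_smul, Matrix.smul_mul, Matrix.mul_smul, smul_smul, ← inv_pow, sq]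
  have hunit {M : Matrix m n ℝ} (hM : M ≠ 0) : ‖‖M‖⁻¹ • M‖ = 1 := by
    rw [norm_smul, norm_inv, norm_norm, inv_mul_cancel₀ (norm_ne_zero_iff.mpr hM)]
  have h := frobenius_norm_gram_sub_le (‖X‖⁻¹ • X) (‖Y‖⁻¹ • Y)
  rw [hunit hX, hunit hY] at h
  rw [hgram, hgram]
  calc _ ≤ (1 + 1) * ‖‖X‖⁻¹ • X - ‖Y‖⁻¹ • Y‖ := h
    _ ≤ (1 + 1) * (2 * ‖X - Y‖ / ‖X‖) := by
      gcongr
      exact norm_inv_norm_smul_sub_le hX hY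
    _ = 4 * ‖X - Y‖ / ‖X‖ := by ring

end FrobeniusNorm

/-- For nonzero `n × d` real matrices `X, Y`,
`‖XXᵀ/‖X‖_F² − YYᵀ/‖Y‖_F²‖_F ≤ 4‖X − Y‖_F/‖X‖_F`. -/
theorem frobNorm_normalized_gram_sub_le (n d : ℕ)
    (X Y : Matrix (Fin n) (Fin d) ℝ) (hX : X ≠ 0) (hY : Y ≠ 0) :
    frobNorm ((frobNorm X ^ 2)⁻¹ • (X * Xᵀ) - (frobNorm Y ^ 2)⁻¹ • (Y * Yᵀ)) ≤
      4 * frobNorm (X - Y) / frobNorm X := by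
  simp only [frobNorm_eq_norm]
  exact frobenius_norm_normalized_gram_sub_le hX hY
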